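/- Fix n ≥ k ≥ 0 and work on the doubled n-qubit space (ℂ²⊗ℂ²)^{⊗n}. Let ℳ_i denote the single-qubit twirl on factor i, ℳ_i(O) = ∫ (V⊗V)_i O (V⊗V)_i† dV with V Haar on U(2), and let the permutation average be (1/n!) Σ_{P ∈ S_n} P(·), where P ∈ S_n acts by permuting the n tensor factors. Then: (1) the permutation average of ℳ_n ∘ ⋯ ∘ ℳ_1 applied to (I/4)^{⊗k} ⊗ (|0⟩⟨0| ⊗ |0⟩⟨0|)^{⊗(n−k)} equals 3^{−(n−k)} Σ_{S=0}^{n−k} C(n−k, S) 2^{n−k−S} |S⟩; and (2) the same average applied to (𝒮/2)^{⊗k} ⊗ (|0⟩⟨0| ⊗ |0⟩⟨0|)^{⊗(n−k)} equals 3^{−(n−k)} Σ_{S=0}^{n−k} C(n−k, S) 2^{n−k−S} |S+k⟩. -/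

import Mathlib

open Matrix Kronecker MeasureTheory

noncomputable section

/-- The swap operator `𝒮` on `ℂ² ⊗ ℂ²`, `𝒮(u ⊗ v) = v ⊗ u`. -/
def swapOp : Matrix (Fin 2 × Fin 2) (Fin 2 × Fin 2) ℂ :=
  Matrix.of fun p q => if p.1 = q.2 ∧ p.2 = q.1 then 1 else 0

/-- The single-site operators `O_0 = I/4` and `O_1 = 𝒮/2` on a doubled qubit. -/
noncomputable def O01 (b : Fin 2) : Matrix (Fin 2 × Fin 2) (Fin 2 × Fin 2) ℂ :=
  if b = 0 then (4 : ℂ)⁻¹ • 1 else (2 : ℂ)⁻¹ • swapOp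

/-- Tensor product over the sites of single-site operators on the doubled space. -/
def tensorSites {ι : Type*} [Fintype ι]
    (f : ι → Matrix (Fin 2 × Fin 2) (Fin 2 × Fin 2) ℂ) :
    Matrix (ι → Fin 2 × Fin 2) (ι → Fin 2 × Fin 2) ℂ :=
  Matrix.of fun x y => ∏ i, f i (x i) (y i)

/-- The symmetrized basis operator
`|S⟩ = C(n,S)⁻¹ ∑_{|σ| = S} ⊗ᵢ O_{σᵢ}` on the doubled space. -/
noncomputable def basisS {ι : Type*} [Fintype ι] [DecidableEq ι] (S : ℕ) :
    Matrix (ι → Fin 2 × Fin 2) (ι → Fin 2 × Fin 2) ℂ :=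
  (((Fintype.card ι).choose S : ℂ))⁻¹ •
    ∑ σ ∈ Finset.univ.filter
        (fun σ : ι → Fin 2 => (Finset.univ.filter fun i => σ i = 1).card = S),
      tensorSites fun i => O01 (σ i)

/-- `𝕊 = 𝒮^{⊗n}`: the two-copy swap applied to every site. -/
def fullSwapSites (ι : Type*) [Fintype ι] :
    Matrix (ι → Fin 2 × Fin 2) (ι → Fin 2 × Fin 2) ℂ :=
  tensorSites fun _ => swapOp

instance matrixMeasurableSpace {m n : Type*} : MeasurableSpace (Matrix m n ℂ) :=
  inferInstanceAs (MeasurableSpace (m → n → ℂ))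

/-- `μ` is a (left-invariant) Haar probability measure on a group of unitaries. -/
def IsHaarProb {G : Type*} [Group G] [MeasurableSpace G] (μ : MeasureTheory.Measure G) : Prop :=
  MeasureTheory.IsProbabilityMeasure μ ∧
    ∀ (g : G) (s : Set G), MeasurableSet s → μ ((g * ·) ⁻¹' s) = μ s

/-- The unitary group `U(2)` acting on one qubit. -/
abbrev U2 := Matrix.unitaryGroup (Fin 2) ℂ

/-- Entrywise Bochner integral of the single-qubit twirl
`V ↦ (V ⊗ V) O (V ⊗ V)†` over `μ`. -/
noncomputable def twirlAvg (μ : MeasureTheory.Measure U2)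
    (O : Matrix (Fin 2 × Fin 2) (Fin 2 × Fin 2) ℂ) :
    Matrix (Fin 2 × Fin 2) (Fin 2 × Fin 2) ℂ :=
  Matrix.of fun p q =>
    ∫ V : U2,
      ((((V : Matrix (Fin 2) (Fin 2) ℂ) ⊗ₖ (V : Matrix (Fin 2) (Fin 2) ℂ)) * O *
        (((V : Matrix (Fin 2) (Fin 2) ℂ) ⊗ₖ (V : Matrix (Fin 2) (Fin 2) ℂ))ᴴ)) p q) ∂μ

/-- Embed a single-site doubled operator `M` at site `i`, acting as the identity elsewhere. -/
def actAt {ι : Type*} [Fintype ι] [DecidableEq ι] (i : ι)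
    (M : Matrix (Fin 2 × Fin 2) (Fin 2 × Fin 2) ℂ) :
    Matrix (ι → Fin 2 × Fin 2) (ι → Fin 2 × Fin 2) ℂ :=
  Matrix.of fun x y =>
    M (x i) (y i) * ∏ l ∈ Finset.univ.filter (· ≠ i), (if x l = y l then (1 : ℂ) else 0)

/-- The single-qubit Haar twirl `ℳᵢ` at site `i` (entrywise Bochner integral). -/
noncomputable def twirlAt {ι : Type*} [Fintype ι] [DecidableEq ι]
    (μ : MeasureTheory.Measure U2) (i : ι)
    (O : Matrix (ι → Fin 2 × Fin 2) (ι → Fin 2 × Fin 2) ℂ) :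
    Matrix (ι → Fin 2 × Fin 2) (ι → Fin 2 × Fin 2) ℂ :=
  Matrix.of fun x y =>
    ∫ V : U2,
      ((actAt i ((V : Matrix (Fin 2) (Fin 2) ℂ) ⊗ₖ (V : Matrix (Fin 2) (Fin 2) ℂ)) * O *
        (actAt i ((V : Matrix (Fin 2) (Fin 2) ℂ) ⊗ₖ (V : Matrix (Fin 2) (Fin 2) ℂ)))ᴴ) x y) ∂μ

/-- Average over all permutations of the sites:
`(1/n!) ∑_{P ∈ S_n} P(O)`, where `P` permutes the tensor factors. -/
noncomputable def permAvg {ι : Type*} [Fintype ι] [DecidableEq ι]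
    (O : Matrix (ι → Fin 2 × Fin 2) (ι → Fin 2 × Fin 2) ℂ) :
    Matrix (ι → Fin 2 × Fin 2) (ι → Fin 2 × Fin 2) ℂ :=
  (((Fintype.card ι).factorial : ℂ))⁻¹ •
    ∑ P : Equiv.Perm ι, Matrix.of fun x y => O (x ∘ P) (y ∘ P)

/-- The projector `|0⟩⟨0| ⊗ |0⟩⟨0|` on a doubled qubit. -/
def ket00 : Matrix (Fin 2 × Fin 2) (Fin 2 × Fin 2) ℂ :=
  (!![1, 0; 0, 0] : Matrix (Fin 2) (Fin 2) ℂ) ⊗ₖ (!![1, 0; 0, 0] : Matrix (Fin 2) (Fin 2) ℂ)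

/-- The single-qubit twirl `ℳₙ ∘ ⋯ ∘ ℳ₁` applied at every site. -/
noncomputable def twirlAllSites {n : ℕ} (μ : Measure U2)
    (O : Matrix (Fin n → Fin 2 × Fin 2) (Fin n → Fin 2 × Fin 2) ℂ) :
    Matrix (Fin n → Fin 2 × Fin 2) (Fin n → Fin 2 × Fin 2) ℂ :=
  (List.finRange n).foldl (fun O i => twirlAt μ i O) O

section TensorSites

variable {ι : Type*} [Fintype ι]

theorem tensorSites_mul [DecidableEq ι] (f g : ι → Matrix (Fin 2 × Fin 2) (Fin 2 × Fin 2) ℂ) :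
    tensorSites f * tensorSites g = tensorSites fun i => f i * g i := by
  ext x y
  simp only [tensorSites, Matrix.mul_apply, Matrix.of_apply, ← Finset.prod_mul_distrib]
  rw [Finset.prod_univ_sum, Fintype.piFinset_univ]

theorem tensorSites_conjTranspose (f : ι → Matrix (Fin 2 × Fin 2) (Fin 2 × Fin 2) ℂ) :
    (tensorSites f)ᴴ = tensorSites fun i => (f i)ᴴ := by
  ext x y
  simp [tensorSites, Matrix.conjTranspose_apply]

theorem tensorSites_update_apply [DecidableEq ι]
    (f : ι → Matrix (Fin 2 × Fin 2) (Fin 2 × Fin 2) ℂ) (i : ι)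
    (M : Matrix (Fin 2 × Fin 2) (Fin 2 × Fin 2) ℂ) (x y : ι → Fin 2 × Fin 2) :
    tensorSites (Function.update f i M) x y =
      M (x i) (y i) * ∏ l ∈ Finset.univ.filter (· ≠ i), f l (x l) (y l) := by
  simp only [tensorSites, Matrix.of_apply]
  rw [← Finset.mul_prod_erase Finset.univ _ (Finset.mem_univ i), Function.update_self,
    Finset.filter_ne']
  congr 1
  refine Finset.prod_congr rfl fun l hl => ?_
  rw [Function.update_of_ne (Finset.ne_of_mem_erase hl)]

theorem actAt_eq_tensorSites [DecidableEq ι] (i : ι)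
    (M : Matrix (Fin 2 × Fin 2) (Fin 2 × Fin 2) ℂ) :
    actAt i M = tensorSites (Function.update (fun _ => 1) i M) := by
  ext x y
  rw [tensorSites_update_apply]
  simp [actAt, Matrix.one_apply]

theorem actAt_conj_tensorSites [DecidableEq ι] (i : ι)
    (M : Matrix (Fin 2 × Fin 2) (Fin 2 × Fin 2) ℂ)
    (f : ι → Matrix (Fin 2 × Fin 2) (Fin 2 × Fin 2) ℂ) :
    actAt i M * tensorSites f * (actAt i M)ᴴ =
      tensorSites (Function.update f i (M * f i * Mᴴ)) := by
  rw [actAt_eq_tensorSites, tensorSites_conjTranspose, tensorSites_mul, tensorSites_mul]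
  congr 1
  funext l
  rcases eq_or_ne l i with rfl | h
  · simp
  · simp [Function.update_of_ne h]

theorem twirlAt_tensorSites [DecidableEq ι] (μ : Measure U2) (i : ι)
    (f : ι → Matrix (Fin 2 × Fin 2) (Fin 2 × Fin 2) ℂ) :
    twirlAt μ i (tensorSites f) =
      tensorSites (Function.update f i (twirlAvg μ (f i))) := by
  ext x y
  simp only [twirlAt, Matrix.of_apply, actAt_conj_tensorSites, tensorSites_update_apply,
    twirlAvg]
  exact integral_mul_const _ _

theorem foldl_twirlAt_tensorSites [DecidableEq ι] (μ : Measure U2) (l : List ι) (hl : l.Nodup)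
    (f : ι → Matrix (Fin 2 × Fin 2) (Fin 2 × Fin 2) ℂ) :
    l.foldl (fun O i => twirlAt μ i O) (tensorSites f) =
      tensorSites fun i => if i ∈ l then twirlAvg μ (f i) else f i := by
  induction l generalizing f with
  | nil => simp
  | cons a l ih =>
    obtain ⟨ha, hl⟩ := List.nodup_cons.mp hl
    rw [List.foldl_cons, twirlAt_tensorSites, ih hl]
    congr 1
    funext i
    rcases eq_or_ne i a with rfl | h
    · simp [ha]
    · simp [h]

theorem twirlAllSites_tensorSites {n : ℕ} (μ : Measure U2)
    (f : Fin n → Matrix (Fin 2 × Fin 2) (Fin 2 × Fin 2) ℂ) :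
    twirlAllSites μ (tensorSites f) = tensorSites fun i => twirlAvg μ (f i) := by
  rw [twirlAllSites, foldl_twirlAt_tensorSites μ _ (List.nodup_finRange n)]
  simp

theorem tensorSites_sum_smul [DecidableEq ι] (w : ι → Fin 2 → ℂ) :
    (tensorSites fun i => ∑ c, w i c • O01 c) =
      ∑ σ : ι → Fin 2, (∏ i, w i (σ i)) • tensorSites fun i => O01 (σ i) := by
  ext x y
  simp only [tensorSites, Matrix.sum_apply, Matrix.smul_apply, Matrix.of_apply, smul_eq_mul,
    ← Finset.prod_mul_distrib]
  rw [Finset.prod_univ_sum, Fintype.piFinset_univ]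

end TensorSites

section Permutations

variable {ι : Type*} [Fintype ι]

/-- The Hamming weight of a bit string. -/
def bitWeight (σ : ι → Fin 2) : ℕ := (Finset.univ.filter fun i => σ i = 1).card

theorem bitWeight_comp_perm (σ : ι → Fin 2) (P : Equiv.Perm ι) :
    bitWeight (σ ∘ P) = bitWeight σ := by
  refine Finset.card_bij (fun i _ => P i) (by simp) (by simp) fun b hb => ⟨P.symm b, ?_, ?_⟩
  · simpa using hb
  · simp

theorem exists_perm_comp_eq_of_bitWeight_eq {σ τ : ι → Fin 2} (h : bitWeight σ = bitWeight τ) :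
    ∃ P : Equiv.Perm ι, τ ∘ P = σ := by
  have hc : Fintype.card {i // σ i = 1} = Fintype.card {i // τ i = 1} := by
    rw [Fintype.card_subtype, Fintype.card_subtype]; exact h
  let e := Fintype.equivOfCardEq hc
  refine ⟨e.extendSubtype, funext fun i => ?_⟩
  by_cases hi : σ i = 1
  · exact (e.extendSubtype_mem i hi).trans hi.symm
  · have := e.extendSubtype_not_mem i hi
    simp only [Function.comp_apply]
    omega

variable [DecidableEq ι]

theorem permAvg_sum_smul {κ : Type*} (s : Finset κ) (c : κ → ℂ)
    (A : κ → Matrix (ι → Fin 2 × Fin 2) (ι → Fin 2 × Fin 2) ℂ) :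
    permAvg (∑ j ∈ s, c j • A j) = ∑ j ∈ s, c j • permAvg (A j) := by
  ext x y
  simp only [permAvg, Matrix.smul_apply, Matrix.sum_apply, Matrix.of_apply, smul_eq_mul]
  simp only [Finset.mul_sum]
  rw [Finset.sum_comm]
  refine Finset.sum_congr rfl fun j _ => Finset.sum_congr rfl fun P _ => ?_
  ring

theorem permAvg_tensorSites (f : ι → Matrix (Fin 2 × Fin 2) (Fin 2 × Fin 2) ℂ) :
    permAvg (tensorSites f) =
      ((Fintype.card ι).factorial : ℂ)⁻¹ • ∑ P : Equiv.Perm ι, tensorSites (f ∘ P) := by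
  rw [permAvg, ← Equiv.sum_comp (Equiv.inv (Equiv.Perm ι))]
  congr 1
  refine Finset.sum_congr rfl fun P _ => ?_
  ext x y
  simp only [tensorSites, Matrix.of_apply]
  rw [← Equiv.prod_comp P]
  simp

theorem card_filter_bitWeight (S : ℕ) :
    (Finset.univ.filter fun σ : ι → Fin 2 => bitWeight σ = S).card =
      (Fintype.card ι).choose S := by
  rw [← Finset.card_univ, ← Finset.card_powersetCard]
  refine Finset.card_bij (fun σ _ => Finset.univ.filter fun i => σ i = 1) ?_ ?_ ?_
  · intro σ hσ
    exact Finset.mem_powersetCard.mpr ⟨Finset.subset_univ _, (Finset.mem_filter.mp hσ).2⟩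
  · intro σ _ τ _ h
    funext i
    have := Finset.ext_iff.mp h i
    simp only [Finset.mem_filter, Finset.mem_univ, true_and] at this
    omega
  · intro s hs
    refine ⟨fun i => if i ∈ s then 1 else 0, ?_, ?_⟩
    · rw [Finset.mem_filter, bitWeight]
      simpa using (Finset.mem_powersetCard.mp hs).2
    · simp

theorem permAvg_tensorSites_O01 (σ : ι → Fin 2) :
    permAvg (tensorSites fun i => O01 (σ i)) = basisS (bitWeight σ) := by
  set s := Finset.univ.filter fun τ : ι → Fin 2 => bitWeight τ = bitWeight σ with hs
  have hconst : ∀ τ ∈ s, permAvg (tensorSites fun i => O01 (τ i)) =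
      permAvg (tensorSites fun i => O01 (σ i)) := by
    intro τ hτ
    obtain ⟨Q, rfl⟩ := exists_perm_comp_eq_of_bitWeight_eq (Finset.mem_filter.mp hτ).2
    rw [permAvg_tensorSites, permAvg_tensorSites, ← Equiv.sum_comp (Equiv.mulLeft Q)
      (fun P => tensorSites ((fun i => O01 (σ i)) ∘ P))]
    rfl
  have hperm : ∀ P : Equiv.Perm ι, ∑ τ ∈ s, tensorSites ((fun i => O01 (τ i)) ∘ P) =
      ∑ τ ∈ s, tensorSites fun i => O01 (τ i) := by
    intro P
    refine Finset.sum_bij' (fun τ _ => τ ∘ P) (fun τ _ => τ ∘ P.symm) ?_ ?_ ?_ ?_ ?_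
    · intro τ hτ
      simpa [hs, bitWeight_comp_perm] using hτ
    · intro τ hτ
      simpa [hs, bitWeight_comp_perm] using hτ
    · intro τ _; funext i; simp
    · intro τ _; funext i; simp
    · intro τ _; rfl
  have hsum : ∑ τ ∈ s, permAvg (tensorSites fun i => O01 (τ i)) =
      ∑ τ ∈ s, tensorSites fun i => O01 (τ i) := by
    simp only [permAvg_tensorSites]
    rw [← Finset.smul_sum, Finset.sum_comm, Finset.sum_congr rfl fun P _ => hperm P,
      Finset.sum_const, Finset.card_univ, Fintype.card_perm, ← Nat.cast_smul_eq_nsmul ℂ,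
      smul_smul, inv_mul_cancel₀, one_smul]
    exact_mod_cast Nat.factorial_ne_zero _
  rw [Finset.sum_congr rfl hconst, Finset.sum_const, hs, card_filter_bitWeight,
    ← Nat.cast_smul_eq_nsmul ℂ] at hsum
  have hne : ((Fintype.card ι).choose (bitWeight σ) : ℂ) ≠ 0 := by
    exact_mod_cast (Nat.choose_pos (Finset.card_le_univ _)).ne'
  rw [eq_comm, ← inv_smul_eq_iff₀ hne] at hsum
  exact hsum.symm

/-- Collecting a weighted sum over bit strings by Hamming weight, through the generating
polynomial of the weights. -/
theorem sum_prod_smul_bitWeight {E : Type*} [AddCommGroup E] [Module ℂ E]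
    (w : ι → Fin 2 → ℂ) (F : ℕ → E) :
    ∑ σ : ι → Fin 2, (∏ i, w i (σ i)) • F (bitWeight σ) =
      Polynomial.lsum (fun m => LinearMap.toSpanSingleton ℂ E (F m))
        (∏ i, (Polynomial.C (w i 0) + Polynomial.C (w i 1) * Polynomial.X)) := by
  have hfac : ∀ i, Polynomial.C (w i 0) + Polynomial.C (w i 1) * Polynomial.X =
      ∑ c : Fin 2, Polynomial.C (w i c) * Polynomial.X ^ (if c = 1 then 1 else 0) := by
    intro i
    simp [Fin.sum_univ_two]
  simp only [hfac]
  rw [Finset.prod_univ_sum, Fintype.piFinset_univ, map_sum]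
  refine Finset.sum_congr rfl fun σ _ => ?_
  rw [Finset.prod_mul_distrib, Finset.prod_pow_eq_pow_sum, ← Finset.card_filter, ← map_prod,
    Polynomial.C_mul_X_pow_eq_monomial]
  simp [Polynomial.lsum_apply, Polynomial.sum_monomial_index, bitWeight]

end Permutations

section Twirl

theorem twirlAvg_of_commute (μ : Measure U2) [IsProbabilityMeasure μ]
    (O : Matrix (Fin 2 × Fin 2) (Fin 2 × Fin 2) ℂ)
    (h : ∀ V : Matrix (Fin 2) (Fin 2) ℂ, Commute (V ⊗ₖ V) O) : twirlAvg μ O = O := by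
  ext p q
  have hV : ∀ V : U2, (((V : Matrix (Fin 2) (Fin 2) ℂ) ⊗ₖ (V : Matrix (Fin 2) (Fin 2) ℂ)) * O *
        (((V : Matrix (Fin 2) (Fin 2) ℂ) ⊗ₖ (V : Matrix (Fin 2) (Fin 2) ℂ))ᴴ)) = O := by
    intro V
    have hu : (V : Matrix (Fin 2) (Fin 2) ℂ) * (V : Matrix (Fin 2) (Fin 2) ℂ)ᴴ = 1 :=
      Matrix.mem_unitaryGroup_iff.mp V.2
    rw [(h V).eq, mul_assoc, Matrix.conjTranspose_kronecker, ← Matrix.mul_kronecker_mul, hu,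
      Matrix.one_kronecker_one, mul_one]
  simp [twirlAvg, hV]

theorem commute_kronecker_swapOp (V : Matrix (Fin 2) (Fin 2) ℂ) :
    Commute (V ⊗ₖ V) swapOp := by
  ext ⟨a, b⟩ ⟨c, d⟩
  fin_cases a <;> fin_cases b <;> fin_cases c <;> fin_cases d <;>
    simp [Matrix.mul_apply, Fintype.sum_prod_type, swapOp] <;> ring

theorem twirlAvg_O01 (μ : Measure U2) [IsProbabilityMeasure μ] (b : Fin 2) :
    twirlAvg μ (O01 b) = O01 b := by
  refine twirlAvg_of_commute μ _ fun V => ?_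
  unfold O01
  split_ifs
  · exact (Commute.one_right _).smul_right _
  · exact (commute_kronecker_swapOp V).smul_right _

theorem measurable_unitary_entry (i j : Fin 2) :
    Measurable fun V : U2 => (V : Matrix (Fin 2) (Fin 2) ℂ) i j :=
  (measurable_pi_apply j).comp ((measurable_pi_apply i).comp measurable_subtype_coe)

theorem measurable_unitary_mul_left (g : U2) : Measurable fun V : U2 => g * V := by
  refine Measurable.subtype_mk (measurable_pi_lambda _ fun i => measurable_pi_lambda _ fun j => ?_)
  change Measurable fun V : U2 =>
    ((g : Matrix (Fin 2) (Fin 2) ℂ) * (V : Matrix (Fin 2) (Fin 2) ℂ)) i j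
  simp only [Matrix.mul_apply]
  exact Finset.measurable_sum _ fun k _ => (measurable_unitary_entry k j).const_mul _

theorem IsHaarProb.measurePreserving_mul_left {μ : Measure U2} (hμ : IsHaarProb μ) (g : U2) :
    MeasurePreserving (fun V : U2 => g * V) μ μ := by
  refine ⟨measurable_unitary_mul_left g, Measure.ext fun s hs => ?_⟩
  rw [Measure.map_apply (measurable_unitary_mul_left g) hs]
  exact hμ.2 g s hs

theorem ket00_conj_apply (V : Matrix (Fin 2) (Fin 2) ℂ) (p q : Fin 2 × Fin 2) :
    ((V ⊗ₖ V) * ket00 * (V ⊗ₖ V)ᴴ) p q =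
      V p.1 0 * V p.2 0 * (star (V q.1 0) * star (V q.2 0)) := by
  simp [Matrix.mul_apply, Fintype.sum_prod_type, ket00]

theorem twirlAvg_ket00_apply (μ : Measure U2) (p q : Fin 2 × Fin 2) :
    twirlAvg μ ket00 p q = ∫ V : U2, (V : Matrix (Fin 2) (Fin 2) ℂ) p.1 0 *
      (V : Matrix (Fin 2) (Fin 2) ℂ) p.2 0 * (star ((V : Matrix (Fin 2) (Fin 2) ℂ) q.1 0) *
        star ((V : Matrix (Fin 2) (Fin 2) ℂ) q.2 0)) ∂μ := by
  simp only [twirlAvg, Matrix.of_apply, ket00_conj_apply]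

theorem integrable_ket00_conj (μ : Measure U2) [IsProbabilityMeasure μ] (p q : Fin 2 × Fin 2) :
    Integrable (fun V : U2 => (V : Matrix (Fin 2) (Fin 2) ℂ) p.1 0 *
      (V : Matrix (Fin 2) (Fin 2) ℂ) p.2 0 * (star ((V : Matrix (Fin 2) (Fin 2) ℂ) q.1 0) *
        star ((V : Matrix (Fin 2) (Fin 2) ℂ) q.2 0))) μ := by
  have hm := fun i => measurable_unitary_entry i 0
  refine Integrable.of_bound (C := 1) (Measurable.aestronglyMeasurable ?_) ?_
  · exact ((hm _).mul (hm _)).mul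
      ((Complex.continuous_conj.measurable.comp (hm _)).mul
        (Complex.continuous_conj.measurable.comp (hm _)))
  · refine Filter.Eventually.of_forall fun V => ?_
    have hb := fun i => entry_norm_bound_of_unitary V.2 i 0
    simp only [norm_mul, norm_star]
    exact mul_le_one₀ (mul_le_one₀ (hb _) (norm_nonneg _) (hb _)) (by positivity)
      (mul_le_one₀ (hb _) (norm_nonneg _) (hb _))

theorem twirlAvg_ket00_conj {μ : Measure U2} (hμ : IsHaarProb μ) {g : Matrix (Fin 2) (Fin 2) ℂ}
    (hg : g ∈ Matrix.unitaryGroup (Fin 2) ℂ) (p q : Fin 2 × Fin 2) :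
    twirlAvg μ ket00 p q = ∑ a : Fin 2 × Fin 2, ∑ b : Fin 2 × Fin 2,
      g p.1 a.1 * g p.2 a.2 * (star (g q.1 b.1) * star (g q.2 b.2)) *
        twirlAvg μ ket00 a b := by
  have := hμ.1
  have hmp := hμ.measurePreserving_mul_left ⟨g, hg⟩
  have hi := integrable_ket00_conj μ
  have hpt : ∀ V : U2, ((⟨g, hg⟩ * V : U2) : Matrix (Fin 2) (Fin 2) ℂ) = g * V.1 := fun _ => rfl
  simp only [twirlAvg_ket00_apply, ← integral_const_mul]
  simp_rw [← integral_finsetSum Finset.univ fun b _ => (hi _ b).const_mul _]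
  rw [← integral_finsetSum _ fun a _ => integrable_finsetSum _ fun b _ => (hi a b).const_mul _]
  conv_lhs => rw [← hmp.map_eq]
  rw [integral_map hmp.measurable.aemeasurable
    (by rw [hmp.map_eq]; exact (hi p q).aestronglyMeasurable)]
  refine integral_congr_ae (Filter.Eventually.of_forall fun V => ?_)
  simp only [hpt, Matrix.mul_apply, Fintype.sum_prod_type, Fin.sum_univ_two, star_add, star_mul']
  ring

theorem twirlAvg_ket00_trace (μ : Measure U2) [IsProbabilityMeasure μ] :
    ∑ p : Fin 2 × Fin 2, twirlAvg μ ket00 p p = 1 := by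
  simp only [twirlAvg_ket00_apply]
  rw [← integral_finsetSum _ fun p _ => integrable_ket00_conj μ p p]
  have hpt : ∀ V : U2, ∑ p : Fin 2 × Fin 2, (V : Matrix (Fin 2) (Fin 2) ℂ) p.1 0 *
      (V : Matrix (Fin 2) (Fin 2) ℂ) p.2 0 * (star ((V : Matrix (Fin 2) (Fin 2) ℂ) p.1 0) *
        star ((V : Matrix (Fin 2) (Fin 2) ℂ) p.2 0)) = 1 := by
    intro V
    have h := congrFun (congrFun (Matrix.mem_unitaryGroup_iff'.mp V.2) 0) 0
    simp only [Matrix.mul_apply, Matrix.star_apply, Fin.sum_univ_two, Matrix.one_apply_eq] at h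
    simp only [Fintype.sum_prod_type, Fin.sum_univ_two]
    linear_combination (star (V.1 0 0) * V.1 0 0 + star (V.1 1 0) * V.1 1 0 + 1) * h
  simp only [hpt, integral_const, probReal_univ, one_smul]

/-- Conjugation by `diag(1, i)` shows that entries of the twirl between sectors of different
Hamming weight vanish. -/
theorem twirlAvg_ket00_eq_zero {μ : Measure U2} (hμ : IsHaarProb μ) (p q : Fin 2 × Fin 2)
    (h : (p.1 : ℕ) + p.2 ≠ q.1 + q.2) : twirlAvg μ ket00 p q = 0 := by
  have hg : (!![1, 0; 0, Complex.I] : Matrix (Fin 2) (Fin 2) ℂ) ∈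
      Matrix.unitaryGroup (Fin 2) ℂ := by
    rw [Matrix.mem_unitaryGroup_iff]
    ext i j
    fin_cases i <;> fin_cases j <;> simp [Matrix.mul_apply, Matrix.star_apply]
  have hinv := twirlAvg_ket00_conj hμ hg p q
  have hI : (1 : ℂ) - Complex.I ≠ 0 := by
    intro h0; simpa using congrArg Complex.im h0
  have hI' : (1 : ℂ) + Complex.I ≠ 0 := by
    intro h0; simpa using congrArg Complex.im h0
  obtain ⟨a, b⟩ := p
  obtain ⟨c, d⟩ := q
  fin_cases a <;> fin_cases b <;> fin_cases c <;> fin_cases d <;>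
    simp [Fintype.sum_prod_type] at h hinv ⊢ <;>
    first
    | exact (mul_eq_zero.mp (show _ * ((1 : ℂ) - Complex.I) = 0 by
        linear_combination hinv)).resolve_right hI
    | exact (mul_eq_zero.mp (show _ * ((1 : ℂ) + Complex.I) = 0 by
        linear_combination hinv)).resolve_right hI'
    | linear_combination (1 / 2 : ℂ) * hinv

theorem twirlAvg_ket00 {μ : Measure U2} (hμ : IsHaarProb μ) :
    twirlAvg μ ket00 = (2 / 3 : ℂ) • O01 0 + (1 / 3 : ℂ) • O01 1 := by
  have := hμ.1
  have hz := twirlAvg_ket00_eq_zero hμ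
  have htr := twirlAvg_ket00_trace μ
  have hl : ∀ a b q, twirlAvg μ ket00 (a, b) q = twirlAvg μ ket00 (b, a) q := by
    intro a b q
    simp only [twirlAvg_ket00_apply]
    simp only [mul_comm]
  have hr : ∀ p a b, twirlAvg μ ket00 p (a, b) = twirlAvg μ ket00 p (b, a) := by
    intro p a b
    simp only [twirlAvg_ket00_apply]
    simp only [mul_comm]
  have hX : (!![0, 1; 1, 0] : Matrix (Fin 2) (Fin 2) ℂ) ∈ Matrix.unitaryGroup (Fin 2) ℂ := by
    rw [Matrix.mem_unitaryGroup_iff]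
    ext i j
    fin_cases i <;> fin_cases j <;> simp [Matrix.mul_apply, Matrix.star_apply]
  have hR : (!![3 / 5, 4 / 5; -4 / 5, 3 / 5] : Matrix (Fin 2) (Fin 2) ℂ) ∈
      Matrix.unitaryGroup (Fin 2) ℂ := by
    rw [Matrix.mem_unitaryGroup_iff]
    ext i j
    fin_cases i <;> fin_cases j <;>
      simp [Matrix.mul_apply, Matrix.star_apply, Complex.conj_ofNat] <;> norm_num
  have hXinv := twirlAvg_ket00_conj hμ hX (1, 1) (1, 1)
  have hRinv := twirlAvg_ket00_conj hμ hR (0, 0) (0, 0)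
  simp [Fintype.sum_prod_type, Complex.conj_ofNat] at htr hXinv hRinv
  have e1 := hl 1 0 (0, 1)
  have e2 := hl 1 0 (1, 0)
  have e3 := hr (0, 1) 1 0
  have z1 := hz (0, 0) (0, 1) (by simp)
  have z2 := hz (0, 0) (1, 0) (by simp)
  have z3 := hz (0, 0) (1, 1) (by simp)
  have z4 := hz (0, 1) (0, 0) (by simp)
  have z5 := hz (0, 1) (1, 1) (by simp)
  have z6 := hz (1, 0) (0, 0) (by simp)
  have z7 := hz (1, 0) (1, 1) (by simp)
  have z8 := hz (1, 1) (0, 0) (by simp)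
  have z9 := hz (1, 1) (0, 1) (by simp)
  have z10 := hz (1, 1) (1, 0) (by simp)
  simp only [z1, z2, z3, z4, z5, z6, z7, z8, z9, z10, e1, e2, e3, hXinv] at htr hRinv
  have hx : twirlAvg μ ket00 (0, 0) (0, 0) = 1 / 3 := by
    linear_combination (1 / 3 : ℂ) * htr + (625 / 864 : ℂ) * hRinv
  have hy : twirlAvg μ ket00 (0, 1) (0, 1) = 1 / 6 := by
    linear_combination (1 / 2 : ℂ) * htr - hx
  ext ⟨a, b⟩ ⟨c, d⟩
  fin_cases a <;> fin_cases b <;> fin_cases c <;> fin_cases d <;>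
    simp [z1, z2, z3, z4, z5, z6, z7, z8, z9, z10, e1, e2, e3, hXinv, hx, hy, O01,
      swapOp] <;> norm_num

end Twirl

theorem Fin.prod_ite_lt_pow {M : Type*} [CommMonoid M] {n k : ℕ} (hkn : k ≤ n) (a b : M) :
    ∏ i : Fin n, (if (i : ℕ) < k then a else b) = a ^ k * b ^ (n - k) := by
  rw [Fin.prod_univ_eq_prod_range (fun i => if i < k then a else b) n,
    ← Finset.prod_range_mul_prod_Ico _ hkn,
    Finset.prod_congr rfl fun i hi => if_pos (Finset.mem_range.mp hi),
    Finset.prod_congr rfl fun i hi => if_neg (Finset.mem_Ico.mp hi).1.not_gt]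
  simp

theorem permAvg_twirlAllSites_O01_ket00 {n k : ℕ} (hkn : k ≤ n) {μ : Measure U2}
    (hμ : IsHaarProb μ) (b : Fin 2) :
    permAvg (twirlAllSites μ
        (tensorSites fun i : Fin n => if (i : ℕ) < k then O01 b else ket00)) =
      ∑ S ∈ Finset.range (n - k + 1),
        ((((3 : ℂ) ^ (n - k))⁻¹ * ((n - k).choose S : ℂ) * (2 : ℂ) ^ (n - k - S)) •
          basisS (ι := Fin n) (S + (b : ℕ) * k)) := by
  have := hμ.1
  let w : Fin n → Fin 2 → ℂ := fun i c =>
    if (i : ℕ) < k then (if c = b then 1 else 0) else (if c = 0 then 2 / 3 else 1 / 3)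
  have hw : (fun i : Fin n => twirlAvg μ (if (i : ℕ) < k then O01 b else ket00)) =
      fun i => ∑ c, w i c • O01 c := by
    funext i
    by_cases hi : (i : ℕ) < k
    · simp [w, hi, twirlAvg_O01]
    · simp [w, hi, twirlAvg_ket00 hμ, Fin.sum_univ_two]
  have hpoly : ∏ i, (Polynomial.C (w i 0) + Polynomial.C (w i 1) * Polynomial.X) =
      ∑ S ∈ Finset.range (n - k + 1), Polynomial.monomial (S + (b : ℕ) * k)
        (((3 : ℂ) ^ (n - k))⁻¹ * ((n - k).choose S : ℂ) * (2 : ℂ) ^ (n - k - S)) := by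
    have hi : ∀ i, Polynomial.C (w i 0) + Polynomial.C (w i 1) * Polynomial.X =
        if (i : ℕ) < k then Polynomial.X ^ (b : ℕ) else
          Polynomial.C (3⁻¹ : ℂ) * (Polynomial.X + Polynomial.C 2) := by
      intro i
      by_cases hi : (i : ℕ) < k
      · fin_cases b <;> simp [w, hi]
      · simp only [w, hi, if_false, if_true, one_ne_zero, mul_add, ← Polynomial.C_mul]
        norm_num [add_comm]
    rw [Finset.prod_congr rfl fun i _ => hi i, Fin.prod_ite_lt_pow hkn, mul_pow, add_pow,
      Finset.mul_sum, Finset.mul_sum]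
    refine Finset.sum_congr rfl fun S _ => ?_
    rw [← Polynomial.C_mul_X_pow_eq_monomial]
    simp only [map_mul, map_pow, ← inv_pow, map_natCast]
    ring
  rw [twirlAllSites_tensorSites, hw, tensorSites_sum_smul, permAvg_sum_smul]
  simp only [permAvg_tensorSites_O01]
  rw [sum_prod_smul_bitWeight w (basisS (ι := Fin n)), hpoly, map_sum]
  refine Finset.sum_congr rfl fun S _ => ?_
  simp [Polynomial.lsum_apply, Polynomial.sum_monomial_index]

/-- After single-qubit Haar twirls on every site and an average over site
permutations, the inputs `(I/4)^{⊗k} ⊗ (|00⟩⟨00|)^{⊗(n−k)}` and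
`(𝒮/2)^{⊗k} ⊗ (|00⟩⟨00|)^{⊗(n−k)}` become
`3^{−(n−k)} ∑_{S=0}^{n−k} C(n−k,S) 2^{n−k−S} |S⟩` and
`3^{−(n−k)} ∑_{S=0}^{n−k} C(n−k,S) 2^{n−k−S} |S+k⟩` respectively. -/
theorem first_layer_symmetrization
    (n k : ℕ) (hkn : k ≤ n) (μ : Measure U2) (hμ : IsHaarProb μ) :
    permAvg (twirlAllSites μ
        (tensorSites fun i : Fin n => if (i : ℕ) < k then O01 0 else ket00)) =
      ∑ S ∈ Finset.range (n - k + 1),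
        ((((3 : ℂ) ^ (n - k))⁻¹ * ((n - k).choose S : ℂ) * (2 : ℂ) ^ (n - k - S)) •
          basisS (ι := Fin n) S) ∧
    permAvg (twirlAllSites μ
        (tensorSites fun i : Fin n => if (i : ℕ) < k then O01 1 else ket00)) =
      ∑ S ∈ Finset.range (n - k + 1),
        ((((3 : ℂ) ^ (n - k))⁻¹ * ((n - k).choose S : ℂ) * (2 : ℂ) ^ (n - k - S)) •
          basisS (ι := Fin n) (S + k)) := by
  exact ⟨by simpa using permAvg_twirlAllSites_O01_ket00 hkn hμ 0,
    by simpa using permAvg_twirlAllSites_O01_ket00 hkn hμ 1⟩
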